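/- arXiv:1602.01972 — 4 statements merged into one kernel-verified Lean document; each statement's English description precedes it below -/
import Mathlib

section
/- Let A = M − N = U − V be two proper splittings of a real m×n matrix A such that the range of M + U − A equals the range of A and the null space of M + U − A equals the null space of A. Set B = M(M + U − A)†U. Then B† = U†(M + U − A)M† = M† + U† − U†AM†, the range of B equals the range of A, and the null space of B equals the null space of A. Moreover, if additionally ρ(H) < 1 where H = U†V M†N, then B† = (I − H)A† and B = A(I − H)⁻¹. -/
open Matrix

/-- `G` is the Moore-Penrose inverse of `A` (the four Penrose equations). -/
def IsMoorePenrose {m n : ℕ} (A : Matrix (Fin m) (Fin n) ℝ)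
    (G : Matrix (Fin n) (Fin m) ℝ) : Prop :=
  A * G * A = A ∧ G * A * G = G ∧ (A * G)ᵀ = A * G ∧ (G * A)ᵀ = G * A

/-- `A = U - V` is a proper splitting: `range U = range A` and `null U = null A`. -/
def IsProperSplitting {m n : ℕ} (A U V : Matrix (Fin m) (Fin n) ℝ) : Prop :=
  A = U - V ∧
    LinearMap.range U.mulVecLin = LinearMap.range A.mulVecLin ∧
    LinearMap.ker U.mulVecLin = LinearMap.ker A.mulVecLin

/-- The spectral radius of a real square matrix: the maximum modulus of its
complex eigenvalues. -/
noncomputable def specRad {k : ℕ} (X : Matrix (Fin k) (Fin k) ℝ) : ℝ :=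
  (spectralRadius ℂ (X.map Complex.ofReal)).toReal

namespace IsMoorePenrose

variable {m n : ℕ} {A B : Matrix (Fin m) (Fin n) ℝ} {G K : Matrix (Fin n) (Fin m) ℝ}

theorem mul_mul_eq_of_range_le (hA : IsMoorePenrose A G)
    (h : LinearMap.range B.mulVecLin ≤ LinearMap.range A.mulVecLin) : A * G * B = B := by
  refine ext_of_mulVec_single fun i => ?_
  obtain ⟨w, hw⟩ := h ⟨Pi.single i 1, rfl⟩
  simp only [mulVecLin_apply] at hw
  rw [← mulVec_mulVec, ← hw, mulVec_mulVec, hA.1]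

theorem mul_mul_eq_of_ker_le (hA : IsMoorePenrose A G)
    (h : LinearMap.ker A.mulVecLin ≤ LinearMap.ker B.mulVecLin) : B * (G * A) = B := by
  refine ext_of_mulVec_single fun i => ?_
  have hv : (G * A) *ᵥ Pi.single i 1 - Pi.single i 1 ∈ LinearMap.ker A.mulVecLin := by
    rw [LinearMap.mem_ker, mulVecLin_apply, mulVec_sub, mulVec_mulVec, ← Matrix.mul_assoc, hA.1,
      sub_self]
  have hB := h hv
  rw [LinearMap.mem_ker, mulVecLin_apply, mulVec_sub, mulVec_mulVec, sub_eq_zero] at hB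
  exact hB

/-- The projection `A * A†` depends only on the range of `A`. -/
theorem mul_eq_mul_of_range_eq (hA : IsMoorePenrose A G) (hB : IsMoorePenrose B K)
    (h : LinearMap.range B.mulVecLin = LinearMap.range A.mulVecLin) : B * K = A * G := by
  have h₁ := hA.mul_mul_eq_of_range_le h.le
  have h₂ := hB.mul_mul_eq_of_range_le h.ge
  calc B * K = A * G * (B * K) := by rw [← Matrix.mul_assoc, h₁]
    _ = (B * K * (A * G))ᵀ := by rw [transpose_mul, hA.2.2.1, hB.2.2.1]
    _ = A * G := by rw [← Matrix.mul_assoc, h₂, hA.2.2.1]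

/-- The projection `A† * A` depends only on the null space of `A`. -/
theorem mul_eq_mul_of_ker_eq (hA : IsMoorePenrose A G) (hB : IsMoorePenrose B K)
    (h : LinearMap.ker B.mulVecLin = LinearMap.ker A.mulVecLin) : K * B = G * A := by
  have h₁ := hA.mul_mul_eq_of_ker_le h.ge
  have h₂ := hB.mul_mul_eq_of_ker_le h.le
  calc K * B = K * B * (G * A) := by rw [Matrix.mul_assoc, h₁]
    _ = (G * A * (K * B))ᵀ := by rw [transpose_mul, hA.2.2.2, hB.2.2.2]
    _ = G * A := by rw [Matrix.mul_assoc, h₂, hA.2.2.2]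

theorem range_eq_of_mul_eq_mul (hA : A * G * A = A) (hB : B * K * B = B) (h : B * K = A * G) :
    LinearMap.range B.mulVecLin = LinearMap.range A.mulVecLin := by
  apply le_antisymm
  · rw [← hB, h, Matrix.mul_assoc, mulVecLin_mul]
    exact LinearMap.range_comp_le_range _ _
  · rw [← hA, ← h, Matrix.mul_assoc, mulVecLin_mul]
    exact LinearMap.range_comp_le_range _ _

theorem ker_eq_of_mul_eq_mul (hA : A * G * A = A) (hB : B * K * B = B) (h : K * B = G * A) :
    LinearMap.ker B.mulVecLin = LinearMap.ker A.mulVecLin := by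
  apply le_antisymm
  · rw [← hA, Matrix.mul_assoc, ← h, ← Matrix.mul_assoc, mulVecLin_mul _ B]
    exact LinearMap.ker_le_ker_comp _ _
  · rw [← hB, Matrix.mul_assoc, h, ← Matrix.mul_assoc, mulVecLin_mul _ A]
    exact LinearMap.ker_le_ker_comp _ _

theorem unique (hG : IsMoorePenrose A G) (hK : IsMoorePenrose A K) : K = G := by
  calc K = K * A * K := hK.2.1.symm
    _ = G * (A * K) := by rw [hG.mul_eq_mul_of_ker_eq hK rfl, Matrix.mul_assoc]
    _ = G := by rw [hG.mul_eq_mul_of_range_eq hK rfl, ← Matrix.mul_assoc, hG.2.1]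

end IsMoorePenrose

theorem stmt15 {m n : ℕ} (A M N U V : Matrix (Fin m) (Fin n) ℝ)
    (Ad Md Ud Wd Bd : Matrix (Fin n) (Fin m) ℝ)
    (hA : IsMoorePenrose A Ad) (hM : IsMoorePenrose M Md) (hU : IsMoorePenrose U Ud)
    (hW : IsMoorePenrose (M + U - A) Wd)
    (hPSM : IsProperSplitting A M N) (hPSU : IsProperSplitting A U V)
    (hrange : LinearMap.range (M + U - A).mulVecLin = LinearMap.range A.mulVecLin)
    (hker : LinearMap.ker (M + U - A).mulVecLin = LinearMap.ker A.mulVecLin)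
    -- Bd is the Moore-Penrose inverse of B = M (M + U - A)† U
    (hB : IsMoorePenrose (M * Wd * U) Bd) :
    Bd = Ud * (M + U - A) * Md ∧
    Bd = Md + Ud - Ud * A * Md ∧
    LinearMap.range (M * Wd * U).mulVecLin = LinearMap.range A.mulVecLin ∧
    LinearMap.ker (M * Wd * U).mulVecLin = LinearMap.ker A.mulVecLin ∧
    (specRad (Ud * V * (Md * N)) < 1 →
      Bd = (1 - Ud * V * (Md * N)) * Ad ∧
      M * Wd * U = A * ((1 : Matrix (Fin n) (Fin n) ℝ) - Ud * V * (Md * N))⁻¹) := by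
  obtain ⟨hNA, hMr, hMk⟩ := hPSM
  obtain ⟨hVA, hUr, hUk⟩ := hPSU
  have hN : N = M - A := by rw [hNA]; abel
  have hV : V = U - A := by rw [hVA]; abel
  have pM := hA.mul_eq_mul_of_range_eq hM hMr
  have pU := hA.mul_eq_mul_of_range_eq hU hUr
  have qM := hA.mul_eq_mul_of_ker_eq hM hMk
  have qU := hA.mul_eq_mul_of_ker_eq hU hUk
  have qW := hA.mul_eq_mul_of_ker_eq hW hker
  have qWd : Wd * (A * Ad) = Wd := by
    rw [← hA.mul_eq_mul_of_range_eq hW hrange, ← Matrix.mul_assoc, hW.2.1]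
  have PM : A * Ad * M = M := hA.mul_mul_eq_of_range_le hMr.le
  have MQ : M * (Ad * A) = M := hA.mul_mul_eq_of_ker_le hMk.ge
  have QMd : Ad * A * Md = Md := by rw [← qM, hM.2.1]
  have UdP : Ud * (A * Ad) = Ud := by rw [← pU, ← Matrix.mul_assoc, hU.2.1]
  have QUd : Ad * A * Ud = Ud := by rw [← qU, hU.2.1]
  have QQ : Ad * A * (Ad * A) = Ad * A := by rw [← Matrix.mul_assoc, hA.2.1]
  set W := M + U - A with hWdef
  have BX : M * Wd * U * (Ud * W * Md) = A * Ad := by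
    calc M * Wd * U * (Ud * W * Md) = M * (Wd * (U * Ud)) * W * Md := by
          simp only [Matrix.mul_assoc]
      _ = M * (Wd * W) * Md := by rw [pU, qWd, Matrix.mul_assoc M]
      _ = A * Ad := by rw [qW, MQ, pM]
  have XB : Ud * W * Md * (M * Wd * U) = Ad * A := by
    have hWQ : W * (Ad * A) = W := hA.mul_mul_eq_of_ker_le hker.ge
    calc Ud * W * Md * (M * Wd * U) = Ud * (W * (Md * M)) * Wd * U := by
          simp only [Matrix.mul_assoc]
      _ = Ud * (W * Wd) * U := by rw [qM, hWQ, Matrix.mul_assoc Ud]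
      _ = Ad * A := by rw [hA.mul_eq_mul_of_range_eq hW hrange, UdP, qU]
  have PB : A * Ad * (M * Wd * U) = M * Wd * U := by
    rw [← Matrix.mul_assoc, ← Matrix.mul_assoc, PM]
  have hX : IsMoorePenrose (M * Wd * U) (Ud * W * Md) := by
    refine ⟨by rw [BX, PB], ?_, by rw [BX, hA.2.2.1], by rw [XB, hA.2.2.2]⟩
    rw [XB, ← Matrix.mul_assoc, ← Matrix.mul_assoc, QUd]
  have hBd : Bd = Ud * W * Md := hX.unique hB
  have hBd' : Bd = Md + Ud - Ud * A * Md := by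
    rw [hBd, hWdef, Matrix.mul_sub, Matrix.mul_add, Matrix.sub_mul, Matrix.add_mul,
      Matrix.mul_assoc Ud M, pM, UdP, qU, QMd]
    abel
  rw [← hBd] at BX XB
  refine ⟨hBd, hBd', IsMoorePenrose.range_eq_of_mul_eq_mul hA.1 hB.1 BX,
    IsMoorePenrose.ker_eq_of_mul_eq_mul hA.1 hB.1 XB, fun _ => ?_⟩
  have hH : 1 - Ud * V * (Md * N) = 1 - Ad * A + Bd * A := by
    have UdAQ : Ud * A * (Ad * A) = Ud * A := by
      rw [Matrix.mul_assoc, ← Matrix.mul_assoc A, hA.1]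
    rw [hBd', hN, hV, Matrix.mul_sub, Matrix.mul_sub, qM, qU, Matrix.sub_mul, Matrix.mul_sub,
      Matrix.mul_sub, QQ, ← Matrix.mul_assoc (Ad * A), QMd, UdAQ, Matrix.sub_mul, Matrix.add_mul,
      ← Matrix.mul_assoc (Ud * A)]
    abel
  have BdP : Bd * (A * Ad) = Bd := by
    rw [← BX, ← Matrix.mul_assoc, hB.2.1]
  have hinv : (1 - Ad * A + Bd * A) * (1 - Ad * A + Ad * (M * Wd * U)) = 1 := by
    have h₁ : (1 - Ad * A) * (1 - Ad * A) = 1 - Ad * A := by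
      rw [Matrix.mul_sub, Matrix.sub_mul _ _ (Ad * A), QQ]; simp
    have h₂ : (1 - Ad * A) * (Ad * (M * Wd * U)) = 0 := by
      rw [Matrix.sub_mul, ← Matrix.mul_assoc (Ad * A), hA.2.1]; simp
    have h₃ : Bd * A * (1 - Ad * A) = 0 := by
      rw [Matrix.mul_sub, Matrix.mul_assoc Bd A (Ad * A), ← Matrix.mul_assoc A, hA.1]; simp
    have h₄ : Bd * A * (Ad * (M * Wd * U)) = Ad * A := by
      rw [← Matrix.mul_assoc, Matrix.mul_assoc Bd, BdP, XB]
    rw [Matrix.add_mul, Matrix.mul_add, Matrix.mul_add, h₁, h₂, h₃, h₄]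
    abel
  rw [hH]
  constructor
  · rw [Matrix.add_mul, Matrix.sub_mul, hA.2.1, Matrix.mul_assoc Bd, BdP]; simp
  · rw [inv_eq_right_inv hinv, Matrix.mul_add, Matrix.mul_sub, ← Matrix.mul_assoc A, hA.1,
      ← Matrix.mul_assoc A, PB]
    simp
end

section
/- Let A = M − N = U − V be two proper weak regular splittings of a real m×n semi-monotone matrix A (A† ≥ 0), with the range of M + U − A equal to the range of A and the null space of M + U − A equal to the null space of A. Set H = U†V M†N and B = M(M + U − A)†U, C = B − A. Then A = B − C is a proper weak regular splitting of A with B†C = H, and it is the unique proper splitting of A whose iteration matrix is H (i.e., if A = B̄ − C̄ is a proper splitting with B̄†C̄ = H, then B̄ = B). -/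
open Matrix

section MoorePenrose

variable {m n : ℕ}

theorem IsMoorePenrose.symm {A : Matrix (Fin m) (Fin n) ℝ} {G : Matrix (Fin n) (Fin m) ℝ}
    (h : IsMoorePenrose A G) : IsMoorePenrose G A :=
  ⟨h.2.1, h.1, h.2.2.2, h.2.2.1⟩

theorem IsMoorePenrose.range_mul {A : Matrix (Fin m) (Fin n) ℝ} {G : Matrix (Fin n) (Fin m) ℝ}
    (h : IsMoorePenrose A G) :
    LinearMap.range (A * G).mulVecLin = LinearMap.range A.mulVecLin := by
  apply le_antisymm
  · rw [Matrix.mulVecLin_mul]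
    exact LinearMap.range_comp_le_range _ _
  · conv_lhs => rw [← h.1, Matrix.mulVecLin_mul]
    exact LinearMap.range_comp_le_range _ _

theorem IsMoorePenrose.ker_mul {A : Matrix (Fin m) (Fin n) ℝ} {G : Matrix (Fin n) (Fin m) ℝ}
    (h : IsMoorePenrose A G) :
    LinearMap.ker (G * A).mulVecLin = LinearMap.ker A.mulVecLin := by
  apply le_antisymm
  · conv_rhs => rw [← h.1, Matrix.mul_assoc, Matrix.mulVecLin_mul]
    exact LinearMap.ker_le_ker_comp _ _
  · rw [Matrix.mulVecLin_mul]
    exact LinearMap.ker_le_ker_comp _ _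

/-- The projection `A * G` onto the range of `A` fixes matrices with smaller range. -/
theorem IsMoorePenrose.mul_mul_of_range_le {A M : Matrix (Fin m) (Fin n) ℝ}
    {G : Matrix (Fin n) (Fin m) ℝ} (h : IsMoorePenrose A G)
    (hr : LinearMap.range M.mulVecLin ≤ LinearMap.range A.mulVecLin) : A * G * M = M := by
  apply Matrix.ext_of_mulVec_single
  intro i
  obtain ⟨y, hy⟩ := hr ⟨Pi.single i 1, rfl⟩
  simp only [Matrix.mulVecLin_apply] at hy
  rw [← Matrix.mulVec_mulVec, ← hy, Matrix.mulVec_mulVec, h.1]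

/-- Matrices with larger null space absorb the projection `G * A`. -/
theorem IsMoorePenrose.mul_mul_of_ker_le {A M : Matrix (Fin m) (Fin n) ℝ}
    {G : Matrix (Fin n) (Fin m) ℝ} (h : IsMoorePenrose A G)
    (hk : LinearMap.ker A.mulVecLin ≤ LinearMap.ker M.mulVecLin) : M * (G * A) = M := by
  apply Matrix.ext_of_mulVec_single
  intro i
  have hx : (G * A) *ᵥ Pi.single i 1 - Pi.single i 1 ∈ LinearMap.ker A.mulVecLin := by
    rw [LinearMap.mem_ker, Matrix.mulVecLin_apply, Matrix.mulVec_sub, Matrix.mulVec_mulVec,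
      ← Matrix.mul_assoc, h.1, sub_self]
  have hMx := hk hx
  rw [LinearMap.mem_ker, Matrix.mulVecLin_apply, Matrix.mulVec_sub, Matrix.mulVec_mulVec] at hMx
  exact sub_eq_zero.mp hMx

theorem IsMoorePenrose.mul_eq_of_range_eq {A M : Matrix (Fin m) (Fin n) ℝ}
    {G Md : Matrix (Fin n) (Fin m) ℝ} (h : IsMoorePenrose A G) (hM : IsMoorePenrose M Md)
    (hr : LinearMap.range M.mulVecLin = LinearMap.range A.mulVecLin) : M * Md = A * G := by
  have h₁ : A * G * (M * Md) = M * Md := by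
    rw [← Matrix.mul_assoc, h.mul_mul_of_range_le hr.le]
  have h₂ : M * Md * (A * G) = A * G := by
    rw [← Matrix.mul_assoc, hM.mul_mul_of_range_le hr.ge]
  have h₃ := congrArg Matrix.transpose h₁
  rw [Matrix.transpose_mul, h.2.2.1, hM.2.2.1] at h₃
  exact h₃.symm.trans h₂

theorem IsMoorePenrose.mul_eq_of_ker_eq {A M : Matrix (Fin m) (Fin n) ℝ}
    {G Md : Matrix (Fin n) (Fin m) ℝ} (h : IsMoorePenrose A G) (hM : IsMoorePenrose M Md)
    (hk : LinearMap.ker M.mulVecLin = LinearMap.ker A.mulVecLin) : Md * M = G * A := by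
  have h₁ : Md * M * (G * A) = Md * M := by
    rw [Matrix.mul_assoc, h.mul_mul_of_ker_le hk.ge]
  have h₂ : G * A * (Md * M) = G * A := by
    rw [Matrix.mul_assoc, hM.mul_mul_of_ker_le hk.le]
  have h₃ := congrArg Matrix.transpose h₁
  rw [Matrix.transpose_mul, h.2.2.2, hM.2.2.2] at h₃
  exact h₃.symm.trans h₂

theorem IsMoorePenrose.unique_s16 {A : Matrix (Fin m) (Fin n) ℝ}
    {G X : Matrix (Fin n) (Fin m) ℝ} (h : IsMoorePenrose A G) (hX : IsMoorePenrose A X) :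
    G = X := by
  have h₁ := h.mul_eq_of_range_eq hX rfl
  have h₂ := h.mul_eq_of_ker_eq hX rfl
  rw [← h.2.1, ← h₂, Matrix.mul_assoc, ← h₁, ← Matrix.mul_assoc, hX.2.1]

end MoorePenrose

theorem stmt16 {m n : ℕ} (A M N U V : Matrix (Fin m) (Fin n) ℝ)
    (Ad Md Ud Wd Bd : Matrix (Fin n) (Fin m) ℝ)
    (hA : IsMoorePenrose A Ad) (hM : IsMoorePenrose M Md) (hU : IsMoorePenrose U Ud)
    (hsemi : ∀ i j, 0 ≤ Ad i j)
    -- A = M - N is a proper weak regular splitting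
    (hPSM : IsProperSplitting A M N)
    (hMd : ∀ i j, 0 ≤ Md i j) (hMN : ∀ i j, 0 ≤ (Md * N) i j)
    -- A = U - V is a proper weak regular splitting
    (hPSU : IsProperSplitting A U V)
    (hUd : ∀ i j, 0 ≤ Ud i j) (hUV : ∀ i j, 0 ≤ (Ud * V) i j)
    (hrange : LinearMap.range (M + U - A).mulVecLin = LinearMap.range A.mulVecLin)
    (hker : LinearMap.ker (M + U - A).mulVecLin = LinearMap.ker A.mulVecLin)
    (hW : IsMoorePenrose (M + U - A) Wd)
    -- Bd is the Moore-Penrose inverse of B = M (M + U - A)† U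
    (hB : IsMoorePenrose (M * Wd * U) Bd) :
    IsProperSplitting A (M * Wd * U) (M * Wd * U - A) ∧
    (∀ i j, 0 ≤ Bd i j) ∧
    (∀ i j, 0 ≤ (Bd * (M * Wd * U - A)) i j) ∧
    Bd * (M * Wd * U - A) = Ud * V * (Md * N) ∧
    (∀ (B' C' : Matrix (Fin m) (Fin n) ℝ) (Bd' : Matrix (Fin n) (Fin m) ℝ),
      IsProperSplitting A B' C' → IsMoorePenrose B' Bd' →
      Bd' * C' = Ud * V * (Md * N) → B' = M * Wd * U) := by
  have hMr := hA.mul_eq_of_range_eq hM hPSM.2.1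
  have hMk := hA.mul_eq_of_ker_eq hM hPSM.2.2
  have hUr := hA.mul_eq_of_range_eq hU hPSU.2.1
  have hUk := hA.mul_eq_of_ker_eq hU hPSU.2.2
  have hWr := hA.mul_eq_of_range_eq hW hrange
  have hWk := hA.mul_eq_of_ker_eq hW hker
  have hPM := hA.mul_mul_of_range_le hPSM.2.1.le
  have hPU := hA.mul_mul_of_range_le hPSU.2.1.le
  have hPW := hA.mul_mul_of_range_le hrange.le
  have hMQ := hA.mul_mul_of_ker_le hPSM.2.2.ge
  have hUQ := hA.mul_mul_of_ker_le hPSU.2.2.ge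
  have hWQ := hA.mul_mul_of_ker_le hker.ge
  have hUdP : Ud * (A * Ad) = Ud := by rw [← hUr, ← Matrix.mul_assoc, hU.2.1]
  have hQMd : Ad * A * Md = Md := by rw [← hMk, hM.2.1]
  have hAQ : A * (Ad * A) = A := by rw [← Matrix.mul_assoc, hA.1]
  set W := M + U - A with hWdef
  have hBX : M * Wd * U * (Ud * W * Md) = A * Ad := calc
    _ = M * Wd * ((U * Ud) * W) * Md := by simp only [Matrix.mul_assoc]
    _ = M * (Wd * W) * Md := by rw [hUr, hPW]; simp only [Matrix.mul_assoc]
    _ = A * Ad := by rw [hWk, hMQ, hMr]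
  have hXB : Ud * W * Md * (M * Wd * U) = Ad * A := calc
    _ = Ud * (W * (Md * M)) * Wd * U := by simp only [Matrix.mul_assoc]
    _ = Ud * ((W * Wd) * U) := by rw [hMk, hWQ]; simp only [Matrix.mul_assoc]
    _ = Ad * A := by rw [hWr, hPU, hUk]
  have hX : IsMoorePenrose (M * Wd * U) (Ud * W * Md) := by
    refine ⟨?_, ?_, ?_, ?_⟩
    · rw [hBX, ← Matrix.mul_assoc, ← Matrix.mul_assoc, hPM]
    · rw [hXB, ← Matrix.mul_assoc, ← Matrix.mul_assoc, ← hUk, hU.2.1]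
    · rw [hBX, hA.2.2.1]
    · rw [hXB, hA.2.2.2]
  have hBd : Bd = Ud * W * Md := hB.unique_s16 hX
  have hBd_add : Bd = Ud + Ud * V * Md := by
    have hV : V = U - A := by rw [hPSU.1]; abel
    have hUM : Ud * M * Md = Ud := by rw [Matrix.mul_assoc, hMr, hUdP]
    rw [hBd, hWdef, hV, Matrix.mul_sub, Matrix.mul_add, Matrix.sub_mul, Matrix.add_mul,
      Matrix.mul_sub, Matrix.sub_mul, hUM]
    abel
  have hiter : Bd * (M * Wd * U - A) = Ud * V * (Md * N) := by
    have hN : N = M - A := by rw [hPSM.1]; abel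
    have hVQ : V * (Ad * A) = V := by
      have hV : V = U - A := by rw [hPSU.1]; abel
      rw [hV, Matrix.sub_mul, hUQ, hAQ]
    have hUA : Ud * A = Ad * A - Ud * V := by
      rw [← hUk, ← Matrix.mul_sub]
      congr 1
      exact hPSU.1
    rw [Matrix.mul_sub, hBd, hXB, ← hBd, hBd_add, hN, Matrix.mul_sub, hMk, Matrix.mul_sub,
      Matrix.add_mul, hUA, Matrix.mul_assoc Ud V (Ad * A), hVQ, Matrix.mul_assoc (Ud * V) Md A]
    abel
  have hnonneg {a b c : ℕ} {S : Matrix (Fin a) (Fin b) ℝ} {T : Matrix (Fin b) (Fin c) ℝ}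
      (hS : ∀ i j, 0 ≤ S i j) (hT : ∀ i j, 0 ≤ T i j) (i : Fin a) (j : Fin c) :
      0 ≤ (S * T) i j := by
    rw [Matrix.mul_apply]
    exact Finset.sum_nonneg fun k _ => mul_nonneg (hS i k) (hT k j)
  refine ⟨⟨by abel, ?_, ?_⟩, ?_, ?_, hiter, ?_⟩
  · rw [← hX.range_mul, hBX, hA.range_mul]
  · rw [← hX.ker_mul, hXB, hA.ker_mul]
  · intro i j
    rw [hBd_add]
    exact add_nonneg (hUd i j) (hnonneg hUV hMd i j)
  · rw [hiter]
    exact hnonneg hUV hMN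
  · intro B' C' Bd' hPS hB' hH
    have hBk' := hA.mul_eq_of_ker_eq hB' hPS.2.2
    have hBr' := hA.mul_eq_of_range_eq hB' hPS.2.1
    have hC : C' = B' - A := by rw [hPS.1]; abel
    have hBdA : Bd' * A = Bd * A := by
      rw [← hiter, hC, Matrix.mul_sub, hBk', Matrix.mul_sub, hBd, hXB] at hH
      rw [hBd]
      exact sub_right_injective hH
    have hBdEq : Bd' = Bd := calc
      Bd' = Bd' * (A * Ad) := by rw [← hBr', ← Matrix.mul_assoc, hB'.2.1]
      _ = Bd * (A * Ad) := by rw [← Matrix.mul_assoc, hBdA, Matrix.mul_assoc]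
      _ = Bd := by rw [← hBX, ← hBd, ← Matrix.mul_assoc, hB.2.1]
    rw [hBdEq] at hB'
    exact hB'.symm.unique_s16 hB.symm
end

section
/- Let A be a real m×n semi-monotone matrix (A† ≥ 0), and let A = M − N = U − V be two proper regular splittings of A such that the range of M + U − A equals the range of A and the null space of M + U − A equals the null space of A. Suppose every row sum of U† and every row sum of M† is positive. Then ρ(U†V M†N) ≤ min{ρ(U†V), ρ(M†N)} < 1. -/
open Matrix

theorem nonneg_mul {k l p : ℕ} {X : Matrix (Fin k) (Fin l) ℝ} {Y : Matrix (Fin l) (Fin p) ℝ}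
    (hX : ∀ i j, 0 ≤ X i j) (hY : ∀ i j, 0 ≤ Y i j) (i j) : 0 ≤ (X * Y) i j := by
  rw [Matrix.mul_apply]
  exact Finset.sum_nonneg fun _ _ => mul_nonneg (hX _ _) (hY _ _)

theorem nonneg_mulVec {k l : ℕ} {X : Matrix (Fin k) (Fin l) ℝ} {v : Fin l → ℝ}
    (hX : ∀ i j, 0 ≤ X i j) (hv : ∀ i, 0 ≤ v i) (i) : 0 ≤ (X *ᵥ v) i := by
  simp only [Matrix.mulVec, dotProduct]
  exact Finset.sum_nonneg fun _ _ => mul_nonneg (hX _ _) (hv _)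

theorem specRad_le_of_mulVec_le {k : ℕ} {T : Matrix (Fin k) (Fin k) ℝ} (hT : ∀ i j, 0 ≤ T i j)
    {x : Fin k → ℝ} (hx : ∀ i, 0 < x i) {c : ℝ} (hc : 0 ≤ c) (h : ∀ i, (T *ᵥ x) i ≤ c * x i) :
    specRad T ≤ c := by
  refine ENNReal.toReal_le_of_le_ofReal hc (iSup₂_le fun μ hμ => ?_)
  rw [← Matrix.spectrum_toLin', ← Module.End.hasEigenvalue_iff_mem_spectrum] at hμ
  obtain ⟨v, hv, hv0⟩ := hμ.exists_hasEigenvector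
  rw [Module.End.mem_eigenspace_iff, Matrix.toLin'_apply] at hv
  obtain ⟨j₀, hj₀⟩ := Function.ne_iff.mp hv0
  obtain ⟨i, -, hi⟩ := Finset.exists_max_image Finset.univ (fun i => ‖v i‖ / x i) ⟨j₀, by simp⟩
  have hvi : 0 < ‖v i‖ := by
    have h1 : 0 < ‖v j₀‖ / x j₀ := div_pos (norm_pos_iff.mpr hj₀) (hx _)
    exact (div_pos_iff_of_pos_right (hx i)).mp (h1.trans_le (hi j₀ (Finset.mem_univ _)))
  have hle : ‖μ‖ * ‖v i‖ ≤ c * ‖v i‖ := by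
    calc ‖μ‖ * ‖v i‖ = ‖(T.map Complex.ofReal *ᵥ v) i‖ := by rw [hv]; simp
      _ ≤ ∑ j, T i j * ‖v j‖ := by
        simp only [Matrix.mulVec, dotProduct]
        refine (norm_sum_le _ _).trans (Finset.sum_le_sum fun j _ => ?_)
        simp [abs_of_nonneg (hT i j)]
      _ ≤ ∑ j, ‖v i‖ / x i * (T i j * x j) := by
        refine Finset.sum_le_sum fun j _ => ?_
        have := (div_le_iff₀ (hx j)).mp (hi j (Finset.mem_univ _))
        calc T i j * ‖v j‖ ≤ T i j * (‖v i‖ / x i * x j) :=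
              mul_le_mul_of_nonneg_left this (hT i j)
          _ = _ := by ring
      _ = ‖v i‖ / x i * (T *ᵥ x) i := by rw [← Finset.mul_sum]; rfl
      _ ≤ ‖v i‖ / x i * (c * x i) :=
        mul_le_mul_of_nonneg_left (h i) (div_nonneg hvi.le (hx i).le)
      _ = c * ‖v i‖ := by have := (hx i).ne'; field_simp
  rw [← enorm_eq_nnnorm, ← ofReal_norm]
  exact ENNReal.ofReal_le_ofReal (le_of_mul_le_mul_right hle hvi)

section

attribute [local instance] Matrix.linftyOpNormedRing Matrix.linftyOpNormedAlgebra

open Filter Topology in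
theorem exists_eventually_norm_pow_le {k : ℕ} (S : Matrix (Fin k) (Fin k) ℝ) {c : ℝ}
    (h : specRad S < c) :
    ∃ r : ℝ, 0 ≤ r ∧ r < c ∧ ∀ᶠ l : ℕ in atTop, ‖S ^ l‖ ≤ r ^ l := by
  set X := S.map Complex.ofReal
  have hfin : spectralRadius ℂ X ≠ ⊤ := by
    refine ne_top_of_le_ne_top ?_ (spectrum.spectralRadius_le_pow_nnnorm_pow_one_div ℂ X 0)
    simp [ENNReal.mul_ne_top]
  obtain ⟨r, hr, hrc⟩ := exists_between h
  have hr0 : 0 ≤ r := ENNReal.toReal_nonneg.trans hr.le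
  refine ⟨r, hr0, hrc, ?_⟩
  have hlt : spectralRadius ℂ X < ENNReal.ofReal r :=
    (ENNReal.lt_ofReal_iff_toReal_lt hfin).mpr hr
  filter_upwards [(spectrum.pow_nnnorm_pow_one_div_tendsto_nhds_spectralRadius X).eventually_lt_const
    hlt, eventually_gt_atTop 0] with l hl hl0
  have hnorm : ‖S ^ l‖ = ‖X ^ l‖ := by
    have : X ^ l = (S ^ l).map Complex.ofReal :=
      (map_pow (Complex.ofRealHom.mapMatrix (m := Fin k)) S l).symm
    rw [this]
    simp [Matrix.linfty_opNorm_def]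
  rw [hnorm]
  have hl1 : (l : ℝ) ≠ 0 := by positivity
  have h2 := ENNReal.rpow_le_rpow hl.le (Nat.cast_nonneg (α := ℝ) l)
  rw [← ENNReal.rpow_mul, one_div_mul_cancel hl1, ENNReal.rpow_one, ENNReal.rpow_natCast,
    ← ENNReal.ofReal_pow hr0] at h2
  rw [← enorm_eq_nnnorm, ← ofReal_norm] at h2
  exact (ENNReal.ofReal_le_ofReal_iff (pow_nonneg hr0 l)).mp h2

open Filter Topology in
theorem exists_pos_smul_eq_mulVec_add {k : ℕ} {S : Matrix (Fin k) (Fin k) ℝ}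
    (hS : ∀ i j, 0 ≤ S i j) {c : ℝ} (h : specRad S < c) {u : Fin k → ℝ} (hu : ∀ i, 0 < u i) :
    ∃ x : Fin k → ℝ, (∀ i, 0 < x i) ∧ c • x = S *ᵥ x + u := by
  obtain ⟨r, hr0, hrc, hr⟩ := exists_eventually_norm_pow_le S h
  have hc : 0 < c := hr0.trans_lt hrc
  let f : ℕ → Fin k → ℝ := fun l => c⁻¹ ^ (l + 1) • (S ^ l *ᵥ u)
  have hf : Summable f := by
    refine Summable.of_norm_bounded_eventually_nat (g := fun l => c⁻¹ * ‖u‖ * (r / c) ^ l)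
      ((summable_geometric_of_lt_one (by positivity) ((div_lt_one hc).mpr hrc)).mul_left _) ?_
    filter_upwards [hr] with l hl
    calc ‖f l‖ = c⁻¹ ^ (l + 1) * ‖S ^ l *ᵥ u‖ := by
          rw [norm_smul, Real.norm_of_nonneg (by positivity)]
      _ ≤ c⁻¹ ^ (l + 1) * (r ^ l * ‖u‖) := by
          gcongr
          exact (Matrix.linfty_opNorm_mulVec _ _).trans (by gcongr)
      _ = c⁻¹ * ‖u‖ * (r / c) ^ l := by rw [div_eq_mul_inv, mul_pow]; ring
  have hrec : ∀ l, c • f (l + 1) = S *ᵥ f l := fun l => by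
    simp only [f, Matrix.mulVec_smul, Matrix.mulVec_mulVec, smul_smul, ← pow_succ']
    congr 1
    rw [pow_succ' c⁻¹ (l + 1), mul_inv_cancel_left₀ hc.ne']
  have heq : c • (∑' l, f l) = S *ᵥ (∑' l, f l) + u := by
    have h1 : S *ᵥ (∑' l, f l) = ∑' l, S *ᵥ f l :=
      (LinearMap.toContinuousLinearMap S.mulVecLin).map_tsum hf
    rw [h1, hf.tsum_eq_zero_add, smul_add, ← ((summable_nat_add_iff 1).mpr hf).tsum_const_smul, add_comm]
    simp only [hrec]
    simp [f, smul_smul, hc.ne']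
  have hfn : ∀ l i, 0 ≤ f l i := by
    intro l
    induction l with
    | zero => intro i; simpa [f] using mul_nonneg (inv_nonneg.mpr hc.le) (hu i).le
    | succ l ih =>
      intro i
      have h1 := congrFun (hrec l) i
      have h2 : 0 ≤ (S *ᵥ f l) i := nonneg_mulVec hS ih i
      rw [← h1, Pi.smul_apply, smul_eq_mul] at h2
      exact nonneg_of_mul_nonneg_right h2 hc
  have hxn : ∀ i, 0 ≤ (∑' l, f l) i := fun i => by
    rw [tsum_apply hf]
    exact tsum_nonneg fun l => hfn l i
  refine ⟨_, fun i => ?_, heq⟩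
  have h1 := congrFun heq i
  have h2 : 0 ≤ (S *ᵥ (∑' l, f l)) i := nonneg_mulVec hS hxn i
  simp only [Pi.smul_apply, Pi.add_apply, smul_eq_mul] at h1
  exact pos_of_mul_pos_right (h1 ▸ add_pos_of_nonneg_of_pos h2 (hu i)) hc.le

end

theorem mul_eq_of_range_le {m n : ℕ} {A U : Matrix (Fin m) (Fin n) ℝ}
    {G : Matrix (Fin n) (Fin m) ℝ} (hG : A * G * A = A)
    (h : LinearMap.range U.mulVecLin ≤ LinearMap.range A.mulVecLin) : A * G * U = U := by
  refine Matrix.ext_of_mulVec_single fun j => ?_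
  obtain ⟨w, hw⟩ := h ⟨Pi.single j 1, rfl⟩
  simp only [Matrix.mulVecLin_apply] at hw
  rw [← Matrix.mulVec_mulVec, ← hw, Matrix.mulVec_mulVec, hG]

theorem mul_eq_of_ker_le {m n : ℕ} {A U : Matrix (Fin m) (Fin n) ℝ}
    {G : Matrix (Fin n) (Fin m) ℝ} (hG : A * G * A = A)
    (h : LinearMap.ker A.mulVecLin ≤ LinearMap.ker U.mulVecLin) : U * (G * A) = U := by
  refine Matrix.ext_of_mulVec_single fun j => ?_
  have : (G * A) *ᵥ Pi.single j 1 - Pi.single j 1 ∈ LinearMap.ker A.mulVecLin := by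
    rw [LinearMap.mem_ker, Matrix.mulVecLin_apply, Matrix.mulVec_sub, Matrix.mulVec_mulVec,
      ← Matrix.mul_assoc, hG, sub_self]
  have := h this
  rwa [LinearMap.mem_ker, Matrix.mulVecLin_apply, Matrix.mulVec_sub, Matrix.mulVec_mulVec,
    sub_eq_zero] at this

theorem eq_of_mul_eq_left {k : ℕ} {P Q : Matrix (Fin k) (Fin k) ℝ} (hP : Pᵀ = P) (hQ : Qᵀ = Q)
    (h1 : P * Q = P) (h2 : Q * P = Q) : P = Q := by
  rw [← hP, ← h1, Matrix.transpose_mul, hP, hQ, h2]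

theorem eq_of_mul_eq_right {k : ℕ} {P Q : Matrix (Fin k) (Fin k) ℝ} (hP : Pᵀ = P) (hQ : Qᵀ = Q)
    (h1 : P * Q = Q) (h2 : Q * P = P) : P = Q := by
  rw [← hQ, ← h1, Matrix.transpose_mul, hP, hQ, h2]

/-- A proper splitting `A = U - V` has `U U† = A A†` and `U† U = A† A`. -/
theorem IsProperSplitting.mul_eq {m n : ℕ} {A U V : Matrix (Fin m) (Fin n) ℝ}
    {Ad Ud : Matrix (Fin n) (Fin m) ℝ} (hs : IsProperSplitting A U V)
    (hA : IsMoorePenrose A Ad) (hU : IsMoorePenrose U Ud) :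
    U * Ud = A * Ad ∧ Ud * U = Ad * A := by
  obtain ⟨-, hr, hk⟩ := hs
  obtain ⟨a1, -, a3, a4⟩ := hA
  obtain ⟨u1, -, u3, u4⟩ := hU
  refine ⟨eq_of_mul_eq_right u3 a3 ?_ ?_, eq_of_mul_eq_left u4 a4 ?_ ?_⟩
  · rw [← Matrix.mul_assoc, mul_eq_of_range_le u1 hr.ge]
  · rw [← Matrix.mul_assoc, mul_eq_of_range_le a1 hr.le]
  · rw [Matrix.mul_assoc, mul_eq_of_ker_le a1 hk.ge]
  · rw [Matrix.mul_assoc, mul_eq_of_ker_le u1 hk.le]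

open Filter Topology in
theorem IsProperSplitting.specRad_lt_one {m n : ℕ} {A U V : Matrix (Fin m) (Fin n) ℝ}
    {Ad Ud : Matrix (Fin n) (Fin m) ℝ} (hs : IsProperSplitting A U V)
    (hA : IsMoorePenrose A Ad) (hU : IsMoorePenrose U Ud) (hsemi : ∀ i j, 0 ≤ Ad i j)
    (hUd : ∀ i j, 0 ≤ Ud i j) (hV : ∀ i j, 0 ≤ V i j) (hrow : ∀ i, 0 < ∑ j, Ud i j) :
    specRad (Ud * V) < 1 := by
  obtain ⟨h1, h2⟩ := hs.mul_eq hA hU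
  have hS := nonneg_mul hUd hV
  have hmul : Ud * V * Ad = Ad - Ud := by
    have hV' : V = U - A := by rw [hs.1]; abel
    rw [hV', Matrix.mul_sub, Matrix.sub_mul, h2, hA.2.1, Matrix.mul_assoc, ← h1,
      ← Matrix.mul_assoc, hU.2.1]
  set x := Ad *ᵥ (1 : Fin m → ℝ)
  set u := Ud *ᵥ (1 : Fin m → ℝ)
  have hu : ∀ i, 0 < u i := fun i => by simpa [u, Matrix.mulVec, dotProduct] using hrow i
  have hSx : (Ud * V) *ᵥ x = x - u := by
    rw [Matrix.mulVec_mulVec, hmul, Matrix.sub_mulVec]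
  have hx : ∀ i, 0 < x i := fun i => by
    have h3 := nonneg_mulVec hS (nonneg_mulVec hsemi fun _ => zero_le_one) i
    change 0 ≤ ((Ud * V) *ᵥ x) i at h3
    rw [hSx, Pi.sub_apply] at h3
    linarith [hu i]
  have hev : ∀ᶠ r : ℝ in 𝓝[<] 1, ∀ i, x i - u i < r * x i := by
    refine eventually_all.mpr fun i => Tendsto.eventually_const_lt (u := x i - u i) (v := 1 * x i)
      (by linarith [hu i]) ?_
    exact ((continuous_id.mul continuous_const).tendsto 1).mono_left nhdsWithin_le_nhds
  obtain ⟨r, hr, hr1, hr0⟩ := (hev.and (eventually_mem_nhdsWithin.and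
    (nhdsWithin_le_nhds (eventually_ge_nhds (zero_lt_one (α := ℝ)))))).exists
  refine (specRad_le_of_mulVec_le hS hx hr0 fun i => ?_).trans_lt hr1
  rw [hSx]
  exact (hr i).le

/-- Comparison: `T = U† V - D A` with `D ≥ 0` supported on the range of `U` has spectral radius
at most that of `U† V`. -/
theorem specRad_le_of_eq_sub {m n : ℕ} {U V : Matrix (Fin m) (Fin n) ℝ}
    {Ud D : Matrix (Fin n) (Fin m) ℝ} {T : Matrix (Fin n) (Fin n) ℝ}
    (hUd : ∀ i j, 0 ≤ Ud i j) (hV : ∀ i j, 0 ≤ V i j) (hrow : ∀ i, 0 < ∑ j, Ud i j)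
    (hlt : specRad (Ud * V) < 1) (hD : ∀ i j, 0 ≤ D i j) (hDU : D * U * Ud = D)
    (hT : ∀ i j, 0 ≤ T i j) (hTD : T = Ud * V - D * (U - V)) :
    specRad T ≤ specRad (Ud * V) := by
  refine le_of_forall_gt_imp_ge_of_dense fun b hb => ?_
  obtain ⟨c, hc, hcb⟩ := exists_between (lt_min hb hlt)
  obtain ⟨hcb, hc1⟩ := lt_min_iff.mp hcb
  have hc0 : 0 < c := lt_of_le_of_lt ENNReal.toReal_nonneg hc
  have hu : ∀ i, 0 < (Ud *ᵥ (1 : Fin m → ℝ)) i := fun i => by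
    simpa [Matrix.mulVec, dotProduct] using hrow i
  obtain ⟨x, hx, hcx⟩ := exists_pos_smul_eq_mulVec_add (nonneg_mul hUd hV) hc hu
  have hkey : c • ((D * (U - V)) *ᵥ x) = (1 - c) • ((D * V) *ᵥ x) + D *ᵥ 1 := by
    have h1 : (D * U) *ᵥ (c • x) = (D * V) *ᵥ x + D *ᵥ 1 := by
      rw [hcx, Matrix.mulVec_add, Matrix.mulVec_mulVec, Matrix.mulVec_mulVec,
        ← Matrix.mul_assoc, hDU]
    rw [Matrix.mul_sub, Matrix.sub_mulVec, smul_sub, ← Matrix.mulVec_smul, h1, sub_smul, one_smul]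
    abel
  refine (specRad_le_of_mulVec_le hT hx hc0.le fun i => ?_).trans hcb.le
  have h1 := congrFun hkey i
  have h2 := congrFun hcx i
  simp only [Pi.smul_apply, Pi.add_apply, smul_eq_mul] at h1 h2
  have h3 : 0 ≤ ((D * (U - V)) *ᵥ x) i := by
    refine nonneg_of_mul_nonneg_right (h1 ▸ add_nonneg (mul_nonneg (by linarith) ?_) ?_) hc0
    · exact nonneg_mulVec (nonneg_mul hD hV) (fun j => (hx j).le) i
    · exact nonneg_mulVec hD (fun _ => zero_le_one) i
  rw [hTD, Matrix.sub_mulVec, Pi.sub_apply, h2]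
  linarith [hu i]

theorem stmt18 {m n : ℕ} (A M N U V : Matrix (Fin m) (Fin n) ℝ)
    (Ad Md Ud : Matrix (Fin n) (Fin m) ℝ)
    (hA : IsMoorePenrose A Ad) (hM : IsMoorePenrose M Md) (hU : IsMoorePenrose U Ud)
    (hsemi : ∀ i j, 0 ≤ Ad i j)
    -- A = M - N is a proper regular splitting
    (hPSM : IsProperSplitting A M N)
    (hMd : ∀ i j, 0 ≤ Md i j) (hN : ∀ i j, 0 ≤ N i j)
    -- A = U - V is a proper regular splitting
    (hPSU : IsProperSplitting A U V)
    (hUd : ∀ i j, 0 ≤ Ud i j) (hV : ∀ i j, 0 ≤ V i j)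
    (hrange : LinearMap.range (M + U - A).mulVecLin = LinearMap.range A.mulVecLin)
    (hker : LinearMap.ker (M + U - A).mulVecLin = LinearMap.ker A.mulVecLin)
    (hrowU : ∀ i, 0 < ∑ j, Ud i j) (hrowM : ∀ i, 0 < ∑ j, Md i j) :
    specRad (Ud * V * (Md * N)) ≤ min (specRad (Ud * V)) (specRad (Md * N)) ∧
      min (specRad (Ud * V)) (specRad (Md * N)) < 1 := by
  obtain ⟨hM1, hM2⟩ := hPSM.mul_eq hA hM
  obtain ⟨hU1, hU2⟩ := hPSU.mul_eq hA hU
  have hltU := hPSU.specRad_lt_one hA hU hsemi hUd hV hrowU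
  have hltM := hPSM.specRad_lt_one hA hM hsemi hMd hN hrowM
  have hT := nonneg_mul (nonneg_mul hUd hV) (nonneg_mul hMd hN)
  have hVA : V = U - A := by rw [hPSU.1]; abel
  have hNA : N = M - A := by rw [hPSM.1]; abel
  have hVproj : V * (Md * M) = V := by
    rw [hM2, hVA, Matrix.sub_mul, ← Matrix.mul_assoc A, hA.1, ← hU2, ← Matrix.mul_assoc, hU.1]
  have hMdproj : Ud * U * Md = Md := by rw [hU2, ← hM2, hM.2.1]
  have hMproj : Md * (M * Md) = Md := by rw [← Matrix.mul_assoc, hM.2.1]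
  have hAproj : A * (Md * M) = A := by rw [hM2, ← Matrix.mul_assoc, hA.1]
  have hMA : M * (Md * A) = A := by rw [← Matrix.mul_assoc, hM1, hA.1]
  refine ⟨le_min ?_ ?_, min_lt_of_left_lt hltU⟩
  · refine specRad_le_of_eq_sub (U := U) (D := Ud * V * Md) hUd hV hrowU hltU
      (nonneg_mul (nonneg_mul hUd hV) hMd) ?_ hT ?_
    · rw [Matrix.mul_assoc, hU1, ← hM1, Matrix.mul_assoc, hMproj]
    · rw [← hPSU.1, hNA, Matrix.mul_sub, Matrix.mul_sub, Matrix.mul_assoc Ud V (Md * M), hVproj,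
        Matrix.mul_assoc (Ud * V)]
  · refine specRad_le_of_eq_sub (U := M) (D := Ud * N * Md) hMd hN hrowM hltM
      (nonneg_mul (nonneg_mul hUd hN) hMd) ?_ hT ?_
    · rw [Matrix.mul_assoc, Matrix.mul_assoc (Ud * N), hMproj]
    · have h1 : A * (Md * N) = N * (Md * A) := by
        rw [hNA, Matrix.mul_sub, Matrix.mul_sub, Matrix.sub_mul, hAproj, hMA]
      rw [← hPSM.1, Matrix.mul_assoc (Ud * N), Matrix.mul_assoc Ud N, ← h1, hVA, Matrix.mul_sub,
        Matrix.sub_mul, ← Matrix.mul_assoc (Ud * U), hMdproj, Matrix.mul_assoc Ud A]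
end

section
/- Let A = U − V be a proper splitting of a real m×n matrix A and let b ∈ ℝᵐ. The iteration x⁽ⁱ⁺¹⁾ = U†V x⁽ⁱ⁾ + U†b converges to A†b for every initial vector x⁽⁰⁾ ∈ ℝⁿ if and only if ρ(U†V) < 1. -/
open Matrix

open Filter Topology

section SpectralRadius

open scoped ENNReal

theorem spectralRadius_ne_top {𝕜 A : Type*} [NormedField 𝕜] [NormedRing A] [NormedAlgebra 𝕜 A]
    [CompleteSpace A] (a : A) : spectralRadius 𝕜 a ≠ ∞ := by
  refine ne_top_of_le_ne_top ?_ (spectrum.spectralRadius_le_pow_nnnorm_pow_one_div 𝕜 a 0)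
  simp [ENNReal.mul_eq_top]

theorem spectralRadius_lt_one_of_tendsto_pow {𝕜 A : Type*} [NormedField 𝕜] [NormedRing A]
    [NormedAlgebra 𝕜 A] [CompleteSpace A] {a : A} (h : Tendsto (a ^ ·) atTop (𝓝 0)) :
    spectralRadius 𝕜 a < 1 := by
  have h1 : Tendsto (fun n : ℕ => ‖a ^ (n + 1)‖₊ * ‖(1 : A)‖₊) atTop (𝓝 0) := by
    simpa using ((h.comp (tendsto_add_atTop_nat 1)).nnnorm).mul_const ‖(1 : A)‖₊
  obtain ⟨n, hn⟩ := (h1.eventually_lt_const zero_lt_one).exists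
  refine (spectrum.spectralRadius_le_pow_nnnorm_pow_one_div 𝕜 a n).trans_lt ?_
  rw [← ENNReal.mul_rpow_of_nonneg _ _ (by positivity)]
  exact ENNReal.rpow_lt_one (mod_cast hn) (by positivity)

theorem tendsto_pow_of_spectralRadius_lt_one {A : Type*} [NormedRing A] [NormedAlgebra ℂ A]
    [CompleteSpace A] {a : A} (h : spectralRadius ℂ a < 1) : Tendsto (a ^ ·) atTop (𝓝 0) := by
  obtain ⟨r, hr, hr1⟩ := ENNReal.lt_iff_exists_nnreal_btwn.1 h
  have hr1 : r < 1 := mod_cast hr1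
  refine squeeze_zero_norm' (a := fun n => (r : ℝ) ^ n) ?_
    (tendsto_pow_atTop_nhds_zero_of_lt_one r.2 hr1)
  filter_upwards [(spectrum.pow_nnnorm_pow_one_div_tendsto_nhds_spectralRadius a).eventually_lt_const
    hr, eventually_gt_atTop 0] with n hn hn0
  rw [one_div, ENNReal.rpow_inv_lt_iff (by positivity), ENNReal.rpow_natCast] at hn
  exact_mod_cast hn.le

end SpectralRadius

section MatrixPowers

attribute [local instance] Matrix.linftyOpNormedRing Matrix.linftyOpNormedAlgebra

theorem Matrix.tendsto_pow_iff_spectralRadius_lt_one {n : Type*} [Fintype n] [DecidableEq n]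
    (X : Matrix n n ℂ) : Tendsto (X ^ ·) atTop (𝓝 0) ↔ spectralRadius ℂ X < 1 :=
  ⟨spectralRadius_lt_one_of_tendsto_pow, tendsto_pow_of_spectralRadius_lt_one⟩

theorem Matrix.spectralRadius_ne_top {n : Type*} [Fintype n] [DecidableEq n]
    (X : Matrix n n ℂ) : spectralRadius ℂ X ≠ ⊤ :=
  _root_.spectralRadius_ne_top X

end MatrixPowers

theorem Matrix.tendsto_map_ofReal_zero_iff {ι m n : Type*} {l : Filter ι}
    {X : ι → Matrix m n ℝ} :
    Tendsto (fun i => (X i).map Complex.ofReal) l (𝓝 0) ↔ Tendsto X l (𝓝 0) := by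
  refine tendsto_pi_nhds.trans (Iff.trans ?_ tendsto_pi_nhds.symm)
  refine forall_congr' fun i => tendsto_pi_nhds.trans (Iff.trans ?_ tendsto_pi_nhds.symm)
  refine forall_congr' fun j => ?_
  exact (Complex.isometry_ofReal.isEmbedding.tendsto_nhds_iff (y := 0)).symm

theorem specRad_lt_one_iff {k : ℕ} (X : Matrix (Fin k) (Fin k) ℝ) :
    specRad X < 1 ↔ Tendsto (X ^ ·) atTop (𝓝 0) := by
  rw [specRad, ← ENNReal.toReal_one,
    ENNReal.toReal_lt_toReal (Matrix.spectralRadius_ne_top _) ENNReal.one_ne_top,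
    ← Matrix.tendsto_pow_iff_spectralRadius_lt_one, ← Matrix.tendsto_map_ofReal_zero_iff]
  refine Eq.to_iff (congrArg (Tendsto · _ _) (funext fun i => ?_))
  exact (map_pow (Complex.ofRealHom.mapMatrix (m := Fin k)) X i).symm

theorem Matrix.tendsto_zero_iff_mulVec {ι m n R : Type*} [Fintype n] [DecidableEq n]
    [NonAssocSemiring R] [TopologicalSpace R] [IsTopologicalSemiring R]
    {l : Filter ι} {X : ι → Matrix m n R} :
    Tendsto X l (𝓝 0) ↔ ∀ v, Tendsto (fun i => X i *ᵥ v) l (𝓝 0) := by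
  constructor
  · intro h v
    have hc : Continuous fun Y : Matrix m n R => Y *ᵥ v := by fun_prop
    simpa [Function.comp_def] using (hc.tendsto 0).comp h
  · intro h
    refine tendsto_pi_nhds.2 fun i => tendsto_pi_nhds.2 fun j => ?_
    simpa using tendsto_pi_nhds.1 (h (Pi.single j 1)) i

/-- An affine iteration with a fixed point `p` converges to `p` from every initial vector iff the
powers of its matrix tend to zero. -/
theorem Matrix.affine_iteration_tendsto_iff {n R : Type*} [Fintype n] [DecidableEq n] [Ring R]
    [TopologicalSpace R] [IsTopologicalRing R] (H : Matrix n n R) {c p : n → R}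
    (hp : H *ᵥ p + c = p) :
    (∀ x : ℕ → n → R, (∀ i, x (i + 1) = H *ᵥ x i + c) → Tendsto x atTop (𝓝 p)) ↔
      Tendsto (H ^ ·) atTop (𝓝 0) := by
  rw [Matrix.tendsto_zero_iff_mulVec]
  constructor
  · intro h v
    have := h (fun i => H ^ i *ᵥ v + p) fun i => by
      rw [pow_succ', ← mulVec_mulVec, mulVec_add, add_assoc, hp]
    simpa using this.sub_const p
  · intro h x hx
    have hpow (i : ℕ) : x i = H ^ i *ᵥ (x 0 - p) + p := by
      induction i with
      | zero => simp
      | succ i ih =>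
        rw [hx, ih, pow_succ', ← mulVec_mulVec, mulVec_add, add_assoc, hp]
    rw [funext hpow]
    simpa using (h (x 0 - p)).add_const p

section MoorePenrose

variable {m n : ℕ} {A B : Matrix (Fin m) (Fin n) ℝ} {G K : Matrix (Fin n) (Fin m) ℝ}

theorem IsMoorePenrose.mul_mul_of_range_le_s19 (hA : IsMoorePenrose A G)
    (h : LinearMap.range B.mulVecLin ≤ LinearMap.range A.mulVecLin) : A * G * B = B := by
  refine Matrix.ext_of_mulVec_single fun i => ?_
  obtain ⟨w, hw⟩ := h ⟨Pi.single i 1, rfl⟩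
  simp only [mulVecLin_apply] at hw
  rw [← mulVec_mulVec, ← hw, mulVec_mulVec, hA.1]

theorem IsMoorePenrose.mul_mul_of_ker_le_s19 (hA : IsMoorePenrose A G)
    (h : LinearMap.ker A.mulVecLin ≤ LinearMap.ker B.mulVecLin) : B * (G * A) = B := by
  refine Matrix.ext_of_mulVec_single fun i => ?_
  have hk : Pi.single i 1 - (G * A) *ᵥ Pi.single i 1 ∈ LinearMap.ker A.mulVecLin := by
    rw [LinearMap.mem_ker, mulVecLin_apply, mulVec_sub, mulVec_mulVec, ← Matrix.mul_assoc, hA.1,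
      sub_self]
  have hB := h hk
  rw [LinearMap.mem_ker, mulVecLin_apply, mulVec_sub, mulVec_mulVec, sub_eq_zero] at hB
  exact hB.symm

theorem IsMoorePenrose.mul_inverse_eq_of_range_eq (hA : IsMoorePenrose A G)
    (hB : IsMoorePenrose B K)
    (h : LinearMap.range B.mulVecLin = LinearMap.range A.mulVecLin) : A * G = B * K := by
  calc A * G = (A * G)ᵀ := hA.2.2.1.symm
    _ = (B * K * (A * G))ᵀ := by
      rw [← Matrix.mul_assoc, hB.mul_mul_of_range_le_s19 h.ge]
    _ = A * G * B * K := by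
      rw [transpose_mul, hA.2.2.1, hB.2.2.1, ← Matrix.mul_assoc]
    _ = B * K := by rw [hA.mul_mul_of_range_le_s19 h.le]

theorem IsMoorePenrose.inverse_mul_eq_of_ker_eq (hA : IsMoorePenrose A G)
    (hB : IsMoorePenrose B K)
    (h : LinearMap.ker B.mulVecLin = LinearMap.ker A.mulVecLin) : G * A = K * B := by
  calc G * A = (G * A)ᵀ := hA.2.2.2.symm
    _ = (G * (A * (K * B)))ᵀ := by rw [hB.mul_mul_of_ker_le_s19 h.le]
    _ = K * (B * (G * A)) := by
      rw [← Matrix.mul_assoc G, transpose_mul, hA.2.2.2, hB.2.2.2, Matrix.mul_assoc]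
    _ = K * B := by rw [hA.mul_mul_of_ker_le_s19 h.ge]

/-- The Moore-Penrose inverse of `A` is a fixed point of the iteration `X ↦ U†VX + U†` given by a
proper splitting `A = U - V`. -/
theorem IsProperSplitting.fixed_point {U V : Matrix (Fin m) (Fin n) ℝ}
    (hPS : IsProperSplitting A U V) (hA : IsMoorePenrose A G) (hU : IsMoorePenrose U K) :
    K * V * G + K = G := by
  obtain ⟨hs, hr, hk⟩ := hPS
  have hV : V = U - A := by rw [hs, sub_sub_cancel]
  have h1 : K * U * G = G := by rw [← hA.inverse_mul_eq_of_ker_eq hU hk, hA.2.1]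
  have h2 : K * A * G = K := by
    rw [Matrix.mul_assoc, hA.mul_inverse_eq_of_range_eq hU hr, ← Matrix.mul_assoc, hU.2.1]
  rw [hV, Matrix.mul_sub, Matrix.sub_mul, h1, h2, sub_add_cancel]

end MoorePenrose

theorem stmt19 {m n : ℕ} (A U V : Matrix (Fin m) (Fin n) ℝ)
    (Ad Ud : Matrix (Fin n) (Fin m) ℝ)
    (hA : IsMoorePenrose A Ad) (hU : IsMoorePenrose U Ud)
    (hPS : IsProperSplitting A U V) (b : Fin m → ℝ) :
    (∀ x : ℕ → Fin n → ℝ,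
        (∀ i, x (i + 1) = (Ud * V).mulVec (x i) + Ud.mulVec b) →
        Filter.Tendsto x Filter.atTop (nhds (Ad.mulVec b))) ↔
      specRad (Ud * V) < 1 := by
  rw [specRad_lt_one_iff]
  refine Matrix.affine_iteration_tendsto_iff _ ?_
  rw [mulVec_mulVec, ← add_mulVec, hPS.fixed_point hA hU]
end
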